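/- arXiv:0709.3016 — 3 statements merged into one kernel-verified Lean document; each statement's English description precedes it below -/
import Mathlib

section
/- There exists a v-matrix {P_α : α < κ(v)} such that α < β implies that P_β refines P_α, and moreover for every *-segment ⟨A,B⟩* there exist α < κ(v) and a member ⟨C,D⟩* ∈ P_α with ⟨C,D⟩* ⊆ ⟨A,B⟩*. -/
open Set

/-- `A`, `B` form a segment when `A ⊆ B` and `B \ A` is infinite. -/
def IsSeg (A B : Set ℕ) : Prop := A ⊆ B ∧ (B \ A).Infinite

/-- The segment `⟨A,B⟩ = {X ∈ [ω]^ω : A ⊆ X ⊆ B}`. -/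
def Seg (A B : Set ℕ) : Set (Set ℕ) := {X | X.Infinite ∧ A ⊆ X ∧ X ⊆ B}

/-- `X ⊆* Y` : the set `X \ Y` is finite. -/
def AlmostSub (X Y : Set ℕ) : Prop := (X \ Y).Finite

/-- The *-segment `⟨A,B⟩* = {X ∈ [ω]^ω : A ⊆* X ⊆* B}`. -/
def StarSeg (A B : Set ℕ) : Set (Set ℕ) := {X | X.Infinite ∧ AlmostSub A X ∧ AlmostSub X B}

/-- `S` is a v⁰-set: every segment contains a segment disjoint from `S`. -/
def IsVZero (S : Set (Set ℕ)) : Prop :=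
  ∀ A B, IsSeg A B → ∃ C D, IsSeg C D ∧ Seg C D ⊆ Seg A B ∧ Seg C D ∩ S = ∅

/-- `S` is a v-set: every segment contains a segment inside `S` or disjoint from `S`. -/
def IsVSet (S : Set (Set ℕ)) : Prop :=
  ∀ A B, IsSeg A B → ∃ C D, IsSeg C D ∧ Seg C D ⊆ Seg A B ∧
    (Seg C D ⊆ S ∨ Seg C D ∩ S = ∅)

/-- A set of infinite subsets of `ℕ` is a *-segment if it is of the form `⟨A,B⟩*`. -/
def IsStarSeg (P : Set (Set ℕ)) : Prop := ∃ A B, IsSeg A B ∧ P = StarSeg A B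

/-- Two *-segments are *-disjoint when their intersection is countable. -/
def StarDisjoint (P Q : Set (Set ℕ)) : Prop := (P ∩ Q).Countable

/-- A v-partition: a maximal family of pairwise *-disjoint *-segments. -/
def IsVPartition (P : Set (Set (Set ℕ))) : Prop :=
  (∀ X ∈ P, IsStarSeg X) ∧
  (∀ X ∈ P, ∀ Y ∈ P, X ≠ Y → StarDisjoint X Y) ∧
  (∀ R, IsStarSeg R → R ∉ P → ∃ X ∈ P, ¬ StarDisjoint R X)

/-- `P` refines `Q`: every member of `P` is contained in some member of `Q`. -/
def Refines (P Q : Set (Set (Set ℕ))) : Prop := ∀ X ∈ P, ∃ Y ∈ Q, X ⊆ Y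

/-- A v-matrix is a collection of v-partitions. -/
def IsVMatrix (H : Set (Set (Set (Set ℕ)))) : Prop := ∀ P ∈ H, IsVPartition P

/-- A v-matrix `H` is shattering: for every *-segment `⟨A,B⟩*` some partition in `H`
has two distinct members whose intersections with `⟨A,B⟩*` are two different *-segments. -/
def Shattering (H : Set (Set (Set (Set ℕ)))) : Prop :=
  IsVMatrix H ∧ ∀ A B, IsSeg A B → ∃ P ∈ H, ∃ X ∈ P, ∃ Y ∈ P, X ≠ Y ∧
    IsStarSeg (X ∩ StarSeg A B) ∧ IsStarSeg (Y ∩ StarSeg A B) ∧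
    X ∩ StarSeg A B ≠ Y ∩ StarSeg A B

/-- `κ(v)`: the least cardinality of a shattering v-matrix. -/
noncomputable def kappaV : Cardinal :=
  sInf {c : Cardinal | ∃ H : Set (Set (Set (Set ℕ))), Shattering H ∧ Cardinal.mk ↥H = c}

namespace BaseMatrix

open Cardinal

section Order

variable {T : Type} [PartialOrder T]

/-- Two elements of an order are compatible when they have a common lower bound. -/
def Compat (x y : T) : Prop := ∃ r, r ≤ x ∧ r ≤ y

/-- Every element has a member of `D` below it. -/
def IsDenseBelow (D : Set T) : Prop := ∀ t, ∃ r ≤ t, r ∈ D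

/-- A maximal family of pairwise incompatible elements. -/
structure IsMaxAntichain (P : Set T) : Prop where
  eq_of_compat : ∀ x ∈ P, ∀ y ∈ P, Compat x y → x = y
  exists_compat : ∀ t, ∃ x ∈ P, Compat t x

/-- The elements lying below some member of `P`. -/
def below (P : Set T) : Set T := {t | ∃ x ∈ P, t ≤ x}

theorem Compat.symm {x y : T} (h : Compat x y) : Compat y x :=
  let ⟨r, hx, hy⟩ := h
  ⟨r, hy, hx⟩

theorem Compat.mono {x y x' y' : T} (h : Compat x y) (hx : x ≤ x') (hy : y ≤ y') :
    Compat x' y' :=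
  let ⟨r, h₁, h₂⟩ := h
  ⟨r, h₁.trans hx, h₂.trans hy⟩

theorem compat_of_le {x y : T} (h : x ≤ y) : Compat x y := ⟨x, le_rfl, h⟩

theorem isLowerSet_below (P : Set T) : IsLowerSet (below P) :=
  fun _ _ hba ⟨x, hx, hax⟩ ↦ ⟨x, hx, hba.trans hax⟩

theorem IsMaxAntichain.isDenseBelow {P : Set T} (hP : IsMaxAntichain P) :
    IsDenseBelow (below P) := by
  intro t
  obtain ⟨x, hx, r, hrt, hrx⟩ := hP.exists_compat t
  exact ⟨r, hrt, x, hx, hrx⟩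

theorem IsDenseBelow.inter {D E : Set T} (hD : IsDenseBelow D) (hDl : IsLowerSet D)
    (hE : IsDenseBelow E) : IsDenseBelow (D ∩ E) := by
  intro t
  obtain ⟨r, hrt, hr⟩ := hD t
  obtain ⟨q, hqr, hq⟩ := hE r
  exact ⟨q, hqr.trans hrt, hDl hqr hr, hq⟩

theorem exists_isMaxAntichain {U D : Set T} (hUD : U ⊆ D)
    (hU : ∀ x ∈ U, ∀ y ∈ U, Compat x y → x = y) (hD : IsDenseBelow D) :
    ∃ P, U ⊆ P ∧ P ⊆ D ∧ IsMaxAntichain P := by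
  obtain ⟨P, hUP, hP⟩ := zorn_subset_nonempty
    {P : Set T | P ⊆ D ∧ ∀ x ∈ P, ∀ y ∈ P, Compat x y → x = y} (by
      intro c hc hchain _
      refine ⟨⋃₀ c, ⟨Set.sUnion_subset fun s hs ↦ (hc hs).1, ?_⟩,
        fun s hs ↦ Set.subset_sUnion_of_mem hs⟩
      rintro x ⟨s, hs, hxs⟩ y ⟨s', hs', hys⟩ hxy
      rcases hchain.total hs hs' with h | h
      · exact (hc hs').2 x (h hxs) y hys hxy
      · exact (hc hs).2 x hxs y (h hys) hxy) U ⟨hUD, hU⟩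
  refine ⟨P, hUP, hP.prop.1, hP.prop.2, fun t ↦ ?_⟩
  obtain ⟨r, hrt, hr⟩ := hD t
  by_contra! hcon
  have hrP : ∀ x ∈ P, ¬ Compat r x := fun x hx h ↦ hcon x hx (h.mono hrt le_rfl)
  have hmem : insert r P ∈ {P : Set T | P ⊆ D ∧ ∀ x ∈ P, ∀ y ∈ P, Compat x y → x = y} := by
    refine ⟨Set.insert_subset hr hP.prop.1, ?_⟩
    rintro x (rfl | hx) y (rfl | hy) hxy
    · rfl
    · exact (hrP y hy hxy).elim
    · exact (hrP x hx hxy.symm).elim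
    · exact hP.prop.2 x hx y hy hxy
  exact hrP r (hP.le_of_ge hmem (Set.subset_insert r P) (Set.mem_insert r P))
    (compat_of_le le_rfl)

theorem exists_injective_forall_mem {ι T : Type} (A : ι → Set T) (h : ∀ i, #ι ≤ #(A i)) :
    ∃ f : ι → T, Function.Injective f ∧ ∀ i, f i ∈ A i := by
  obtain ⟨r, hwo, hr⟩ := exists_ord_eq ι
  have hne : ∀ i (g : ∀ j, r j i → T),
      (A i \ Set.range fun j : {j // r j i} ↦ g j.1 j.2).Nonempty := by
    intro i g
    by_contra hcon
    rw [Set.not_nonempty_iff_eq_empty, Set.sdiff_eq_empty] at hcon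
    have h₁ := (mk_le_mk_of_subset hcon).trans mk_range_le
    have h₂ : #{j // r j i} < #ι := card_typein_lt i hr
    exact absurd ((h i).trans h₁) (not_le.2 h₂)
  have hwf : WellFounded r := hwo.wf
  let f : ι → T := hwf.fix fun i g ↦ (hne i g).some
  have hf : ∀ i, f i ∈ A i \ Set.range fun j : {j // r j i} ↦ f j.1 := by
    intro i
    have : f i = (hne i fun j _ ↦ f j).some := hwf.fix_eq _ i
    rw [this]
    exact (hne i fun j _ ↦ f j).some_mem
  refine ⟨f, fun i j hij ↦ ?_, fun i ↦ (hf i).1⟩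
  rcases trichotomous_of r i j with hlt | heq | hlt
  · exact ((hf j).2 ⟨⟨i, hlt⟩, hij⟩).elim
  · exact heq
  · exact ((hf i).2 ⟨⟨j, hlt⟩, hij.symm⟩).elim

/-- Inside a dense lower set there is a maximal antichain reaching below every element which is
compatible with continuum many members of an auxiliary maximal antichain. -/
theorem exists_isMaxAntichain_below (hcard : #T ≤ 𝔠) {D : Set T} (hD : IsDenseBelow D)
    (hDl : IsLowerSet D) :
    ∃ P R : Set T, P ⊆ D ∧ R ⊆ D ∧ IsMaxAntichain P ∧ IsMaxAntichain R ∧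
      ∀ s, 𝔠 ≤ #{x // x ∈ R ∧ Compat s x} → ∃ u ∈ P, u ≤ s := by
  obtain ⟨R, -, hRD, hR⟩ := exists_isMaxAntichain (Set.empty_subset D) (by simp) hD
  let S := {s : T // 𝔠 ≤ #{x // x ∈ R ∧ Compat s x}}
  obtain ⟨f, hf, hfR⟩ := exists_injective_forall_mem
    (fun s : S ↦ {x | x ∈ R ∧ Compat s.1 x}) (fun s ↦ ((mk_subtype_le _).trans hcard).trans s.2)
  choose u hus huf using fun s : S ↦ (hfR s).2
  obtain ⟨P, hUP, hPD, hP⟩ := exists_isMaxAntichain (U := Set.range u) (D := D)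
    (by rintro _ ⟨s, rfl⟩; exact hDl (huf s) (hRD (hfR s).1))
    (by
      rintro _ ⟨s, rfl⟩ _ ⟨s', rfl⟩ h
      rw [hf (hR.eq_of_compat _ (hfR s).1 _ (hfR s').1 (h.mono (huf s) (huf s')))]) hD
  exact ⟨P, R, hPD, hRD, hP, hR, fun s hs ↦ ⟨u ⟨s, hs⟩, hUP ⟨_, rfl⟩, hus ⟨s, hs⟩⟩⟩

theorem IsMaxAntichain.mem_below {P : Set T} (hP : IsMaxAntichain P)
    (hsep : ∀ s t : T, (∀ r ≤ s, Compat r t) → s ≤ t) {s : T}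
    (hs : ∀ x ∈ P, ∀ y ∈ P, Compat s x → Compat s y → x = y) : s ∈ below P := by
  obtain ⟨x, hx, hsx⟩ := hP.exists_compat s
  refine ⟨x, hx, hsep s x fun r hr ↦ ?_⟩
  obtain ⟨y, hy, hry⟩ := hP.exists_compat r
  rwa [hs x hx y hy hsx (hry.mono hr le_rfl)]

theorem IsMaxAntichain.eq_of_mem_below {P : Set T} (hP : IsMaxAntichain P) {s x y : T}
    (hs : s ∈ below P) (hx : x ∈ P) (hy : y ∈ P) (hsx : Compat s x) (hsy : Compat s y) :
    x = y := by
  obtain ⟨z, hz, hsz⟩ := hs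
  rw [hP.eq_of_compat x hx z hz (hsx.symm.mono le_rfl hsz),
    hP.eq_of_compat y hy z hz (hsy.symm.mono le_rfl hsz)]

/-- In a homogeneous separative order, families of fewer than `κ` dense lower sets have dense
intersection as soon as fewer than `κ` maximal antichains never shatter. -/
theorem isDenseBelow_iInter {κ : Cardinal.{0}}
    (hsep : ∀ s t : T, (∀ r ≤ s, Compat r t) → s ≤ t)
    (hhom : ∀ s : T, ∃ e : T → T, (∀ a b, e a ≤ e b ↔ a ≤ b) ∧ Set.range e = Set.Iic s)
    (hmin : ∀ (I : Type), #I < κ → ∀ Q : I → Set T, (∀ i, IsMaxAntichain (Q i)) →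
      ∃ s, ∀ i, ∀ x ∈ Q i, ∀ y ∈ Q i, Compat s x → Compat s y → x = y)
    {I : Type} (hI : #I < κ) (D : I → Set T) (hD : ∀ i, IsDenseBelow (D i))
    (hDl : ∀ i, IsLowerSet (D i)) : IsDenseBelow (⋂ i, D i) := by
  intro s
  obtain ⟨e, he, hes⟩ := hhom s
  have hle : ∀ t, e t ≤ s := fun t ↦ by
    have : e t ∈ Set.Iic s := hes ▸ Set.mem_range_self t
    exact this
  have hdense : ∀ i, IsDenseBelow (e ⁻¹' D i) := by
    intro i t
    obtain ⟨r, hrt, hr⟩ := hD i (e t)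
    have : r ∈ Set.range e := hes ▸ hrt.trans (hle t)
    obtain ⟨r, rfl⟩ := this
    exact ⟨r, (he _ _).1 hrt, hr⟩
  choose Q _ hQD hQ using fun i ↦
    exists_isMaxAntichain (Set.empty_subset (e ⁻¹' D i)) (by simp) (hdense i)
  obtain ⟨t, ht⟩ := hmin I hI Q hQ
  refine ⟨e t, hle t, Set.mem_iInter.2 fun i ↦ ?_⟩
  obtain ⟨x, hx, htx⟩ := (hQ i).mem_below hsep (ht i)
  exact hDl i ((he _ _).2 htx) (hQD i hx)

theorem exists_mem_iInter_of_antitone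
    (hσ : ∀ f : ℕ → T, Antitone f → ∃ t, ∀ n, t ≤ f n) [Nonempty T]
    (D : ℕ → Set T) (hD : ∀ n, IsDenseBelow (D n)) (hDl : ∀ n, IsLowerSet (D n)) :
    ∃ t, ∀ n, t ∈ D n := by
  choose g hg hgD using hD
  let f : ℕ → T := fun n ↦ Nat.rec (Classical.arbitrary T) (fun n t ↦ g n t) n
  obtain ⟨t, ht⟩ := hσ f (antitone_nat_of_succ_le fun n ↦ hg n (f n))
  exact ⟨t, fun n ↦ hDl n (ht (n + 1)) (hgD n (f n))⟩

/-- If every element is split by some level of a refining system of maximal antichains and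
countably many levels are always bounded, each element meets continuum many members of some
later antichain. -/
theorem exists_level_continuum {κ : Cardinal.{0}}
    (hσ : ∀ f : ℕ → T, Antitone f → ∃ t, ∀ n, t ≤ f n)
    {P : Ordinal.{0} → Set T} (hP : ∀ α < κ.ord, IsMaxAntichain (P α))
    (hsplit : ∀ s, ∃ α < κ.ord, ∃ x ∈ P α, ∃ y ∈ P α, x ≠ y ∧ Compat s x ∧ Compat s y)
    (hbdd : ∀ a : ℕ → Ordinal.{0}, (∀ n, a n < κ.ord) → ∃ γ < κ.ord, ∀ n, a n < γ) (s : T) :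
    ∃ γ < κ.ord, ∀ R : Set T, IsMaxAntichain R → (∀ α < γ, R ⊆ below (P α)) →
      𝔠 ≤ #{x // x ∈ R ∧ Compat s x} := by
  choose a ha x hx y hy hxy hsx hsy using hsplit
  choose p hps hpx using hsx
  choose q hqs hqy using hsy
  let node : List Bool → T := fun l ↦ l.rec s fun b _ t ↦ cond b (p t) (q t)
  obtain ⟨γ, hγ, hγa⟩ := hbdd
    (fun n ↦ a (node ((Encodable.decode (α := List Bool) n).getD []))) fun n ↦ ha _
  have hnode : ∀ l, a (node l) < γ := fun l ↦ by
    simpa using hγa (Encodable.encode l)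
  refine ⟨γ, hγ, fun R hR hRP ↦ ?_⟩
  let pre : (ℕ → Bool) → ℕ → List Bool := fun f n ↦ n.rec [] fun k l ↦ f k :: l
  have hpre : ∀ f g : ℕ → Bool, ∀ n, (∀ k < n, f k = g k) → pre f n = pre g n := by
    intro f g n h
    induction n with
    | zero => rfl
    | succ n ih =>
      change f n :: pre f n = g n :: pre g n
      rw [h n n.lt_succ_self, ih fun k hk ↦ h k (hk.trans n.lt_succ_self)]
  have hanti : ∀ f, Antitone fun n ↦ node (pre f n) := by
    refine fun f ↦ antitone_nat_of_succ_le fun n ↦ ?_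
    change cond (f n) (p (node (pre f n))) (q (node (pre f n))) ≤ node (pre f n)
    cases f n
    · exact hqs _
    · exact hps _
  choose b hb using fun f ↦ hσ _ (hanti f)
  choose r hrR hbr using fun f ↦ hR.exists_compat (b f)
  have key : ∀ f g : ℕ → Bool, ∀ n, (∀ k < n, f k = g k) → f n = true → g n = false →
      r f ≠ r g := by
    intro f g n hfg hf hg heq
    have hfx : b f ≤ x (node (pre f n)) := by
      have h : b f ≤ cond (f n) (p (node (pre f n))) (q (node (pre f n))) := hb f (n + 1)
      rw [hf] at h
      exact h.trans (hpx _)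
    have hgy : b g ≤ y (node (pre f n)) := by
      have h : b g ≤ cond (g n) (p (node (pre g n))) (q (node (pre g n))) := hb g (n + 1)
      rw [hg, ← hpre f g n hfg] at h
      exact h.trans (hqy _)
    exact hxy _ <| (hP _ (ha _)).eq_of_mem_below (hRP _ (hnode _) (hrR f)) (hx _) (hy _)
      ((hbr f).symm.mono le_rfl hfx) (heq ▸ (hbr g).symm.mono le_rfl hgy)
  have hinj : Function.Injective fun f ↦
      (⟨r f, hrR f, (hbr f).mono (hb f 0) le_rfl⟩ : {x // x ∈ R ∧ Compat s x}) := by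
    intro f g hfg
    have hfg : r f = r g := congrArg Subtype.val hfg
    by_contra hne
    have hex : ∃ n, f n ≠ g n := Function.ne_iff.1 hne
    classical
    have hmin : ∀ k < Nat.find hex, f k = g k := fun k hk ↦ not_not.1 (Nat.find_min hex hk)
    have hne := Nat.find_spec hex
    cases hf : f (Nat.find hex) <;> cases hg : g (Nat.find hex)
    · exact hne (hf.trans hg.symm)
    · exact key g f _ (fun k hk ↦ (hmin k hk).symm) hg hf hfg.symm
    · exact key f g _ hmin hf hg hfg
    · exact hne (hf.trans hg.symm)
  simpa using mk_le_of_injective hinj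

/-- The system of levels built recursively from a choice `G` of a subset of each set. -/
noncomputable def level (G : Set T → Set T) (Q : Ordinal.{0} → Set T) (α : Ordinal.{0}) : Set T :=
  G ({t | ∀ β, ∀ _ : β < α, t ∈ below (level G Q β)} ∩ below (Q α))
termination_by α

/-- An abstract base matrix theorem. -/
theorem exists_base {κ : Cardinal.{0}} [Nonempty T]
    (hsep : ∀ s t : T, (∀ r ≤ s, Compat r t) → s ≤ t)
    (hσ : ∀ f : ℕ → T, Antitone f → ∃ t, ∀ n, t ≤ f n)
    (hhom : ∀ s : T, ∃ e : T → T, (∀ a b, e a ≤ e b ↔ a ≤ b) ∧ Set.range e = Set.Iic s)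
    (hcard : #T ≤ 𝔠)
    (hmin : ∀ (I : Type), #I < κ → ∀ Q : I → Set T, (∀ i, IsMaxAntichain (Q i)) →
      ∃ s, ∀ i, ∀ x ∈ Q i, ∀ y ∈ Q i, Compat s x → Compat s y → x = y)
    {Q : Ordinal.{0} → Set T} (hQ : ∀ α < κ.ord, IsMaxAntichain (Q α))
    (hsplit : ∀ s, ∃ α < κ.ord, ∃ x ∈ Q α, ∃ y ∈ Q α, x ≠ y ∧ Compat s x ∧ Compat s y) :
    ∃ P : Ordinal.{0} → Set T, (∀ α < κ.ord, IsMaxAntichain (P α)) ∧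
      (∀ α β, α < β → β < κ.ord → P β ⊆ below (P α)) ∧
      ∀ s, ∃ α < κ.ord, ∃ x ∈ P α, x ≤ s := by
  have hG : ∀ D : Set T, ∃ P : Set T, IsDenseBelow D → IsLowerSet D → ∃ R : Set T,
      P ⊆ D ∧ R ⊆ D ∧ IsMaxAntichain P ∧ IsMaxAntichain R ∧
      ∀ s, 𝔠 ≤ #{x // x ∈ R ∧ Compat s x} → ∃ u ∈ P, u ≤ s := by
    intro D
    by_cases h : IsDenseBelow D ∧ IsLowerSet D
    · obtain ⟨P, hP⟩ := exists_isMaxAntichain_below hcard h.1 h.2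
      exact ⟨P, fun _ _ ↦ hP⟩
    · exact ⟨∅, fun h₁ h₂ ↦ (h ⟨h₁, h₂⟩).elim⟩
  choose G hG using hG
  let P := level G Q
  let D : Ordinal.{0} → Set T := fun α ↦ {t | ∀ β, ∀ _ : β < α, t ∈ below (P β)} ∩ below (Q α)
  have hPD : ∀ α, P α = G (D α) := fun α ↦ by
    change level G Q α = _
    rw [level]
  have hDl : ∀ α, IsLowerSet (D α) := fun α s t hts hs ↦
    ⟨fun β hβ ↦ isLowerSet_below _ hts (hs.1 β hβ), isLowerSet_below _ hts hs.2⟩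
  have hPmax : ∀ α < κ.ord, IsDenseBelow (D α) ∧ IsMaxAntichain (P α) := by
    intro α
    induction α using WellFoundedLT.induction with
    | ind α ih =>
    intro hα
    have hDα : IsDenseBelow (D α) := by
      have h₁ : IsDenseBelow (⋂ i : α.ToType, below (P (Ordinal.ToType.mk.symm i).1)) := by
        refine isDenseBelow_iInter hsep hhom hmin (by simpa using lt_ord.1 hα) _
          (fun i ↦ ?_) fun i ↦ isLowerSet_below _
        have hi : (Ordinal.ToType.mk.symm i).1 < α := (Ordinal.ToType.mk.symm i).2
        exact (ih _ hi (hi.trans hα)).2.isDenseBelow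
      have h₂ := h₁.inter (isLowerSet_iInter fun i ↦ isLowerSet_below _) (hQ α hα).isDenseBelow
      convert h₂ using 2
      ext t
      simp only [Set.mem_ofPred_eq, Set.mem_iInter]
      refine ⟨fun h i ↦ h _ (Ordinal.ToType.mk.symm i).2, fun h β hβ ↦ ?_⟩
      simpa using h (Ordinal.ToType.mk ⟨β, hβ⟩)
    obtain ⟨R, -, -, h, -⟩ := hG (D α) hDα (hDl α)
    exact ⟨hDα, by rwa [hPD]⟩
  have hPsub : ∀ α < κ.ord, P α ⊆ D α := fun α hα ↦ by
    obtain ⟨R, h, -⟩ := hG (D α) (hPmax α hα).1 (hDl α)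
    rwa [hPD]
  have href : ∀ α β, α < β → β < κ.ord → P β ⊆ below (P α) := fun α β hαβ hβ t ht ↦
    (hPsub β hβ ht).1 α hαβ
  have hPQ : ∀ α < κ.ord, below (P α) ⊆ below (Q α) := fun α hα t ⟨x, hx, htx⟩ ↦
    isLowerSet_below _ htx (hPsub α hα hx).2
  have hsplit' : ∀ s, ∃ α < κ.ord, ∃ x ∈ P α, ∃ y ∈ P α, x ≠ y ∧ Compat s x ∧ Compat s y := by
    intro s
    by_contra! hcon
    obtain ⟨α, hα, x, hx, y, hy, hxy, hsx, hsy⟩ := hsplit s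
    refine hxy ((hQ α hα).eq_of_mem_below (hPQ α hα ?_) hx hy hsx hsy)
    refine (hPmax α hα).2.mem_below hsep fun z hz w hw hsz hsw ↦ ?_
    by_contra hzw
    exact hcon α hα z hz w hw hzw hsz hsw
  refine ⟨P, fun α hα ↦ (hPmax α hα).2, href, fun s ↦ ?_⟩
  obtain ⟨γ, hγ, h⟩ := exists_level_continuum hσ (fun α hα ↦ (hPmax α hα).2) hsplit' (by
    intro a ha
    by_contra! hcon
    obtain ⟨t, ht⟩ := exists_mem_iInter_of_antitone hσ (fun n ↦ below (P (a n)))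
      (fun n ↦ (hPmax _ (ha n)).2.isDenseBelow) fun n ↦ isLowerSet_below _
    obtain ⟨α, hα, x, hx, y, hy, hxy, htx, hty⟩ := hsplit' t
    obtain ⟨n, hn⟩ := hcon α hα
    refine hxy ((hPmax α hα).2.eq_of_mem_below ?_ hx hy htx hty)
    rcases hn.eq_or_lt with h | h
    · exact h ▸ ht n
    · obtain ⟨z, hz, htz⟩ := ht n
      exact isLowerSet_below _ htz (href _ _ h (ha n) hz)) s
  obtain ⟨R, -, hRD, -, hR, hRs⟩ := hG (D γ) (hPmax γ hγ).1 (hDl γ)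
  obtain ⟨u, hu, hus⟩ := hRs s (h R hR fun α hα t ht ↦ (hRD ht).1 α hα)
  exact ⟨γ, hγ, u, by rwa [hPD], hus⟩

end Order

section Segments

theorem _root_.AlmostSub.of_subset {X Y : Set ℕ} (h : X ⊆ Y) : AlmostSub X Y := by
  simp [AlmostSub, Set.sdiff_eq_empty.2 h]

theorem _root_.AlmostSub.refl (X : Set ℕ) : AlmostSub X X := .of_subset subset_rfl

theorem _root_.AlmostSub.trans {X Y Z : Set ℕ} (h₁ : AlmostSub X Y) (h₂ : AlmostSub Y Z) :
    AlmostSub X Z :=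
  (Set.Finite.union h₁ h₂).subset fun x hx ↦ by
    by_cases hy : x ∈ Y
    · exact .inr ⟨hy, hx.2⟩
    · exact .inl ⟨hx.1, hy⟩

theorem union_image_sdiff {g : ℕ → ℕ} (hg : Function.Injective g) {A : Set ℕ}
    (hA : ∀ n, g n ∉ A) (X Y : Set ℕ) : (A ∪ g '' X) \ (A ∪ g '' Y) = g '' (X \ Y) := by
  rw [Set.image_sdiff hg]
  ext n
  simp only [Set.mem_sdiff, Set.mem_union, not_or]
  refine ⟨fun ⟨h₁, h₂, h₃⟩ ↦ ⟨h₁.resolve_left h₂, h₃⟩, fun ⟨h₁, h₂⟩ ↦ ⟨.inr h₁, ?_, h₂⟩⟩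
  obtain ⟨m, -, rfl⟩ := h₁
  exact hA m

theorem _root_.AlmostSub.union_image_iff {g : ℕ → ℕ} (hg : Function.Injective g) {A : Set ℕ}
    (hA : ∀ n, g n ∉ A) {X Y : Set ℕ} :
    AlmostSub (A ∪ g '' X) (A ∪ g '' Y) ↔ AlmostSub X Y := by
  rw [AlmostSub, union_image_sdiff hg hA, Set.finite_image_iff hg.injOn, AlmostSub]

theorem exists_infinite_split {S : Set ℕ} (hS : S.Infinite) :
    ∃ E ⊆ S, E.Infinite ∧ (S \ E).Infinite := by
  let f := hS.natEmbedding
  have hf : Function.Injective fun n ↦ (f n : ℕ) := fun _ _ h ↦ f.injective (Subtype.ext h)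
  refine ⟨Set.range fun n ↦ (f (2 * n) : ℕ), ?_, ?_, ?_⟩
  · rintro _ ⟨n, rfl⟩
    exact (f _).2
  · exact Set.infinite_range_of_injective fun a b h ↦ by simpa using hf h
  · refine (Set.infinite_range_of_injective (f := fun n ↦ (f (2 * n + 1) : ℕ))
      fun a b h ↦ by simpa using hf h).mono ?_
    rintro _ ⟨n, rfl⟩
    refine ⟨(f _).2, ?_⟩
    rintro ⟨m, hm⟩
    have : 2 * m = 2 * n + 1 := hf hm
    omega

theorem starSeg_subset_iff {A B C D : Set ℕ} (hAB : AlmostSub A B) (h : (B \ A).Infinite) :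
    StarSeg A B ⊆ StarSeg C D ↔ AlmostSub C A ∧ AlmostSub B D := by
  constructor
  · intro hsub
    have hB : B ∈ StarSeg A B := ⟨h.mono Set.sdiff_subset, hAB, .refl B⟩
    refine ⟨?_, (hsub hB).2.2⟩
    obtain ⟨E, hE, hEi, hEi'⟩ := exists_infinite_split h
    have hmem : ∀ F ⊆ B \ A, F.Infinite → AlmostSub C (A ∪ F) := fun F hF hFi ↦ by
      refine (hsub ⟨hFi.mono Set.subset_union_right, .of_subset Set.subset_union_left, ?_⟩).2.1
      refine Set.Finite.subset hAB ?_
      rintro x ⟨hx | hx, hxB⟩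
      · exact ⟨hx, hxB⟩
      · exact (hxB (hF hx).1).elim
    refine (Set.Finite.union (hmem E hE hEi) (hmem _ Set.sdiff_subset hEi')).subset ?_
    rintro x ⟨hxC, hxA⟩
    by_cases hxE : x ∈ E
    · exact .inr ⟨hxC, fun hx ↦ hx.elim hxA fun hx ↦ hx.2 hxE⟩
    · exact .inl ⟨hxC, fun hx ↦ hx.elim hxA hxE⟩
  · rintro ⟨h₁, h₂⟩ X ⟨hX, hAX, hXB⟩
    exact ⟨hX, h₁.trans hAX, hXB.trans h₂⟩

theorem isStarSeg_starSeg {A B : Set ℕ} (hAB : AlmostSub A B) (h : (B \ A).Infinite) :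
    IsStarSeg (StarSeg A B) := by
  have h' : (B \ (A ∩ B)).Infinite := by rwa [Set.sdiff_inter_self_eq_sdiff]
  refine ⟨A ∩ B, B, ⟨Set.inter_subset_right, h'⟩, ?_⟩
  refine ((starSeg_subset_iff hAB h).2 ⟨.of_subset Set.inter_subset_left, .refl B⟩).antisymm
    ((starSeg_subset_iff (.of_subset Set.inter_subset_right) h').2 ⟨?_, .refl B⟩)
  rwa [AlmostSub, Set.sdiff_self_inter]

theorem _root_.IsStarSeg.not_countable {X : Set (Set ℕ)} (hX : IsStarSeg X) : ¬ X.Countable := by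
  obtain ⟨A, B, ⟨hAB, h⟩, rfl⟩ := hX
  intro hc
  obtain ⟨E, hE, hEi, hEi'⟩ := exists_infinite_split h
  let f := hEi.natEmbedding
  let g : ℕ → ℕ := fun n ↦ f n
  have hg : Function.Injective g := fun _ _ h ↦ f.injective (Subtype.ext h)
  have hgE : ∀ n, g n ∈ E := fun n ↦ (f n).2
  have hpre := hc.preimage_of_injOn (f := fun Y : Set ℕ ↦ (B \ E) ∪ g '' Y) (by
    intro Y _ Z _ hYZ
    have hYZ : (B \ E) ∪ g '' Y = (B \ E) ∪ g '' Z := hYZ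
    have key : ∀ Y n, n ∈ Y ↔ g n ∈ (B \ E) ∪ g '' Y := fun Y n ↦ by
      simp [hgE, hg.eq_iff]
    ext n
    rw [key, hYZ, ← key])
  have huniv : (fun Y : Set ℕ ↦ (B \ E) ∪ g '' Y) ⁻¹' StarSeg A B = Set.univ := by
    refine Set.eq_univ_of_forall fun Y ↦ ⟨hEi'.mono ?_, .of_subset ?_, .of_subset ?_⟩
    · exact fun x hx ↦ .inl ⟨hx.1.1, hx.2⟩
    · exact fun x hx ↦ .inl ⟨hAB hx, fun hxE ↦ (hE hxE).2 hx⟩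
    · rintro x (hx | ⟨n, -, rfl⟩)
      · exact hx.1
      · exact (hE (hgE n)).1
  rw [huniv, Set.countable_univ_iff, ← Cardinal.mk_le_aleph0_iff, Cardinal.mk_set_nat] at hpre
  exact absurd hpre (not_le.2 Cardinal.aleph0_lt_continuum)

theorem starSeg_inter (A B C D : Set ℕ) :
    StarSeg A B ∩ StarSeg C D = StarSeg (A ∪ C) (B ∩ D) := by
  ext X
  simp only [StarSeg, AlmostSub, Set.mem_inter_iff, Set.mem_ofPred_eq, Set.union_sdiff_distrib,
    Set.sdiff_inter, Set.finite_union]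
  tauto

theorem countable_setOf_almostSub (A B : Set ℕ) (h : (B \ A).Finite) :
    (StarSeg A B).Countable := by
  have hc : {S : Set ℕ | S.Finite}.Countable := Set.Countable.ofPred_finite
  refine ((hc.prod hc).image fun p ↦ (A \ p.1) ∪ p.2).mono fun X hX ↦ ?_
  refine ⟨(A \ X, X \ A), ⟨hX.2.1, (Set.Finite.union hX.2.2 h).subset fun x hx ↦ ?_⟩, ?_⟩
  · by_cases hxB : x ∈ B
    · exact .inr ⟨hxB, hx.2⟩
    · exact .inl ⟨hx.1, hxB⟩
  · ext x
    simp
    tauto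

theorem _root_.IsStarSeg.inter_iff {X Y : Set (Set ℕ)} (hX : IsStarSeg X) (hY : IsStarSeg Y) :
    IsStarSeg (X ∩ Y) ↔ ¬ StarDisjoint X Y := by
  refine ⟨fun h ↦ h.not_countable, fun h ↦ ?_⟩
  obtain ⟨A, B, -, rfl⟩ := hX
  obtain ⟨C, D, -, rfl⟩ := hY
  rw [StarDisjoint] at h
  rw [starSeg_inter] at h ⊢
  obtain ⟨Z, hZ⟩ : (StarSeg (A ∪ C) (B ∩ D)).Nonempty := by
    by_contra hne
    exact h (by simp [Set.not_nonempty_iff_eq_empty.1 hne])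
  exact isStarSeg_starSeg (hZ.2.1.trans hZ.2.2) fun hf ↦ h (countable_setOf_almostSub _ _ hf)

/-- The type of *-segments, ordered by inclusion. -/
abbrev StarSegment : Type := {X : Set (Set ℕ) // IsStarSeg X}

/-- The *-segment with given almost-included end points. -/
def StarSegment.mk (A B : Set ℕ) (h : AlmostSub A B ∧ (B \ A).Infinite) : StarSegment :=
  ⟨StarSeg A B, isStarSeg_starSeg h.1 h.2⟩

theorem StarSegment.exists_eq_mk (s : StarSegment) : ∃ A B h, s = StarSegment.mk A B h := by
  obtain ⟨_, A, B, h, rfl⟩ := s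
  exact ⟨A, B, ⟨.of_subset h.1, h.2⟩, rfl⟩

theorem StarSegment.mk_le_mk {A B C D : Set ℕ} {h h'} :
    StarSegment.mk A B h ≤ StarSegment.mk C D h' ↔ AlmostSub C A ∧ AlmostSub B D :=
  starSeg_subset_iff h.1 h.2

theorem StarSegment.compat_iff {s t : StarSegment} : Compat s t ↔ ¬ StarDisjoint s.1 t.1 := by
  rw [← s.2.inter_iff t.2]
  refine ⟨fun ⟨r, hrs, hrt⟩ ↦ ?_, fun h ↦ ⟨⟨_, h⟩, Set.inter_subset_left, Set.inter_subset_right⟩⟩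
  rw [s.2.inter_iff t.2]
  exact fun hc ↦ r.2.not_countable (hc.mono (Set.subset_inter hrs hrt))

theorem StarSegment.almostSub_of_compat {A B C D : Set ℕ} {h h'}
    (hc : Compat (StarSegment.mk A B h) (StarSegment.mk C D h')) :
    AlmostSub A D ∧ AlmostSub C B := by
  obtain ⟨r, h₁, h₂⟩ := hc
  obtain ⟨E, F, hEF, rfl⟩ := r.exists_eq_mk
  rw [mk_le_mk] at h₁ h₂
  exact ⟨h₁.1.trans (hEF.1.trans h₂.2), h₂.1.trans (hEF.1.trans h₁.2)⟩

theorem StarSegment.separative (s t : StarSegment) (h : ∀ r ≤ s, Compat r t) : s ≤ t := by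
  obtain ⟨A, B, hAB, rfl⟩ := s.exists_eq_mk
  obtain ⟨C, D, hCD, rfl⟩ := t.exists_eq_mk
  obtain ⟨hAD, hCB⟩ := almostSub_of_compat (h _ le_rfl)
  rw [mk_le_mk]
  constructor
  · by_contra hCA
    have hinf : ((C ∩ B) \ A).Infinite := fun hf ↦ hCA <| (Set.Finite.union hCB hf).subset
      fun x hx ↦ by
        by_cases hxB : x ∈ B
        · exact .inr ⟨⟨hx.1, hxB⟩, hx.2⟩
        · exact .inl ⟨hx.1, hxB⟩
    obtain ⟨E, hE, hEi, hEi'⟩ := exists_infinite_split hinf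
    have hseg : AlmostSub A (B \ E) ∧ ((B \ E) \ A).Infinite := by
      refine ⟨Set.Finite.subset hAB.1 ?_, hEi'.mono ?_⟩
      · exact fun x hx ↦ ⟨hx.1, fun hxB ↦ hx.2 ⟨hxB, fun hxE ↦ (hE hxE).2 hx.1⟩⟩
      · exact fun x hx ↦ ⟨⟨hx.1.1.2, hx.2⟩, hx.1.2⟩
    have hc := (almostSub_of_compat (h (.mk A (B \ E) hseg)
      (mk_le_mk.2 ⟨.refl A, .of_subset Set.sdiff_subset⟩))).2
    exact hEi (Set.Finite.subset hc fun x hx ↦ ⟨(hE hx).1.1, fun hx' ↦ hx'.2 hx⟩)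
  · by_contra hBD
    have hinf : ((B \ D) \ A).Infinite := fun hf ↦ hBD <| (Set.Finite.union hAD hf).subset
      fun x hx ↦ by
        by_cases hxA : x ∈ A
        · exact .inl ⟨hxA, hx.2⟩
        · exact .inr ⟨hx, hxA⟩
    obtain ⟨E, hE, hEi, hEi'⟩ := exists_infinite_split hinf
    have hseg : AlmostSub (A ∪ E) B ∧ (B \ (A ∪ E)).Infinite := by
      refine ⟨Set.Finite.subset hAB.1 ?_, hEi'.mono ?_⟩
      · rintro x ⟨hx | hx, hxB⟩
        · exact ⟨hx, hxB⟩
        · exact (hxB (hE hx).1.1).elim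
      · exact fun x hx ↦ ⟨hx.1.1.1, fun hx' ↦ hx'.elim hx.1.2 hx.2⟩
    have hc := (almostSub_of_compat (h (.mk (A ∪ E) B hseg)
      (mk_le_mk.2 ⟨.of_subset Set.subset_union_left, .refl B⟩))).1
    exact hEi (Set.Finite.subset hc fun x hx ↦ ⟨.inr hx, (hE hx).1.2⟩)

theorem StarSegment.exists_not_compat (s : StarSegment) :
    ∃ t ≤ s, ∃ u ≤ s, ¬ Compat t u := by
  obtain ⟨A, B, hAB, rfl⟩ := s.exists_eq_mk
  obtain ⟨E, hE, hEi, hEi'⟩ := exists_infinite_split hAB.2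
  have h₁ : AlmostSub A (B \ E) ∧ ((B \ E) \ A).Infinite := by
    refine ⟨Set.Finite.subset hAB.1 ?_, hEi'.mono ?_⟩
    · exact fun x hx ↦ ⟨hx.1, fun hxB ↦ hx.2 ⟨hxB, fun hxE ↦ (hE hxE).2 hx.1⟩⟩
    · exact fun x hx ↦ ⟨⟨hx.1.1, hx.2⟩, hx.1.2⟩
  have h₂ : AlmostSub (A ∪ E) B ∧ (B \ (A ∪ E)).Infinite := by
    refine ⟨Set.Finite.subset hAB.1 ?_, hEi'.mono ?_⟩
    · rintro x ⟨hx | hx, hxB⟩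
      · exact ⟨hx, hxB⟩
      · exact (hxB (hE hx).1).elim
    · exact fun x hx ↦ ⟨hx.1.1, fun hx' ↦ hx'.elim hx.1.2 hx.2⟩
  refine ⟨.mk A (B \ E) h₁, mk_le_mk.2 ⟨.refl A, .of_subset Set.sdiff_subset⟩,
    .mk (A ∪ E) B h₂, mk_le_mk.2 ⟨.of_subset Set.subset_union_left, .refl B⟩, fun hc ↦ ?_⟩
  exact hEi (Set.Finite.subset (almostSub_of_compat hc).2
    fun x hx ↦ ⟨.inr hx, fun hx' ↦ hx'.2 hx⟩)

theorem StarSegment.exists_le_of_antitone (f : ℕ → StarSegment) (hf : Antitone f) :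
    ∃ t, ∀ n, t ≤ f n := by
  choose A B h hfn using fun n ↦ (f n).exists_eq_mk
  have hle : ∀ n m, n ≤ m → AlmostSub (A n) (A m) ∧ AlmostSub (B m) (B n) := by
    intro n m hnm
    have := hf hnm
    rwa [hfn, hfn, mk_le_mk] at this
  have hAB : ∀ n m, AlmostSub (A n) (B m) := fun n m ↦
    ((hle n _ (le_max_left n m)).1.trans (h _).1).trans (hle m _ (le_max_right n m)).2
  have hinf : ∀ n, {x | ∀ i ≤ n, x ∈ B i ∧ x ∉ A i}.Infinite := by
    intro n hfin
    have hbad : (⋃ i ∈ Set.Iic n, (A i \ A n ∪ B n \ B i)).Finite :=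
      (Set.finite_Iic n).biUnion fun i hi ↦ Set.Finite.union (hle i n hi).1 (hle i n hi).2
    refine (h n).2 ((hfin.union hbad).subset fun x hx ↦ ?_)
    by_contra hcon
    simp only [Set.mem_union, Set.mem_ofPred_eq, Set.mem_iUnion, Set.mem_sdiff, Set.mem_Iic,
      not_or, not_exists, not_and, not_not] at hcon
    refine hcon.1 fun i hi ↦ ⟨(hcon.2 i hi).2 hx.1, fun hxA ↦ hx.2 ((hcon.2 i hi).1 hxA)⟩
  choose g hg hgt using fun n k ↦ (hinf n).exists_gt k
  let e : ℕ → ℕ := fun n ↦ Nat.rec (g 0 0) (fun n k ↦ g (n + 1) k) n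
  have he : StrictMono e := strictMono_nat_of_lt_succ fun n ↦ hgt (n + 1) (e n)
  have hemem : ∀ n, ∀ i ≤ n, e n ∈ B i ∧ e n ∉ A i := by
    intro n
    cases n with
    | zero => exact hg 0 0
    | succ n => exact hg (n + 1) (e n)
  let E : Set ℕ := Set.range e
  have hE : ∀ n, (E ∩ {x | x ∈ B n → x ∈ A n}).Finite := by
    refine fun n ↦ ((Set.finite_Iio n).image e).subset ?_
    rintro _ ⟨⟨m, rfl⟩, hm⟩
    refine ⟨m, Set.mem_Iio.2 <| lt_of_not_ge fun hnm ↦ ?_, rfl⟩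
    exact (hemem m n hnm).2 (hm (hemem m n hnm).1)
  let C : Set ℕ := ⋃ n, {x | x ∈ A n ∧ ∀ i ≤ n, x ∈ B i}
  have hAC : ∀ n, AlmostSub (A n) C := fun n ↦ by
    refine Set.Finite.subset ((Set.finite_Iic n).biUnion fun i _ ↦ hAB n i) fun x hx ↦ ?_
    by_contra hcon
    simp only [Set.mem_iUnion, Set.mem_sdiff, Set.mem_Iic, not_exists, not_and, not_not] at hcon
    exact hx.2 (Set.mem_iUnion.2 ⟨n, hx.1, fun i hi ↦ hcon i hi hx.1⟩)
  have hCB : ∀ n, AlmostSub C (B n) := fun n ↦ by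
    refine Set.Finite.subset ((Set.finite_Iio n).biUnion fun i _ ↦ hAB i n) fun x hx ↦ ?_
    obtain ⟨m, hm⟩ := Set.mem_iUnion.1 hx.1
    rcases lt_or_ge m n with hmn | hmn
    · exact Set.mem_biUnion (Set.mem_Iio.2 hmn) ⟨hm.1, hx.2⟩
    · exact (hx.2 (hm.2 n hmn)).elim
  have hseg : AlmostSub (C \ E) (C ∪ E) ∧ ((C ∪ E) \ (C \ E)).Infinite := by
    refine ⟨.of_subset fun x hx ↦ .inl hx.1, ?_⟩
    exact (Set.infinite_range_of_injective he.injective).mono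
      fun x hx ↦ ⟨.inr hx, fun hx' ↦ hx'.2 hx⟩
  refine ⟨.mk _ _ hseg, fun n ↦ ?_⟩
  rw [hfn, mk_le_mk]
  constructor
  · refine (Set.Finite.union (hAC n) (hE n)).subset fun x hx ↦ ?_
    by_cases hxC : x ∈ C
    · exact .inr ⟨not_not.1 fun hxE ↦ hx.2 ⟨hxC, hxE⟩, fun _ ↦ hx.1⟩
    · exact .inl ⟨hx.1, hxC⟩
  · refine (Set.Finite.union (hCB n) (hE n)).subset ?_
    rintro x ⟨hx | hx, hxB⟩
    · exact .inl ⟨hx, hxB⟩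
    · exact .inr ⟨hx, fun h ↦ (hxB h).elim⟩

theorem StarSegment.homogeneous (s : StarSegment) :
    ∃ e : StarSegment → StarSegment, (∀ a b, e a ≤ e b ↔ a ≤ b) ∧ Set.range e = Set.Iic s := by
  classical
  obtain ⟨_, A, B, ⟨hAB, hinf⟩, rfl⟩ := s
  have := hinf.to_subtype
  let f := Nat.Subtype.orderIsoOfNat (B \ A)
  let g : ℕ → ℕ := fun n ↦ f n
  have hg : Function.Injective g := fun _ _ h ↦ f.injective (Subtype.ext h)
  have hgB : ∀ n, g n ∈ B := fun n ↦ (f n).2.1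
  have hgA : ∀ n, g n ∉ A := fun n ↦ (f n).2.2
  have hsurj : ∀ x ∈ B, x ∉ A → ∃ n, g n = x := fun x hB hA ↦ by
    obtain ⟨n, hn⟩ := f.surjective ⟨x, hB, hA⟩
    exact ⟨n, congrArg Subtype.val hn⟩
  choose C D h hCD using StarSegment.exists_eq_mk
  have hseg : ∀ t, AlmostSub (A ∪ g '' C t) (A ∪ g '' D t) ∧
      ((A ∪ g '' D t) \ (A ∪ g '' C t)).Infinite := fun t ↦ by
    rw [AlmostSub.union_image_iff hg hgA, union_image_sdiff hg hgA]
    exact ⟨(h t).1, (h t).2.image hg.injOn⟩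
  have hle : ∀ a b, a ≤ b ↔ AlmostSub (C b) (C a) ∧ AlmostSub (D a) (D b) := fun a b ↦ by
    have := mk_le_mk (h := h a) (h' := h b)
    rwa [← hCD, ← hCD] at this
  have hpre : ∀ X, AlmostSub A X → AlmostSub X B → AlmostSub X (A ∪ g '' (g ⁻¹' X)) ∧
      AlmostSub (A ∪ g '' (g ⁻¹' X)) X := fun X hAX hXB ↦ by
    refine ⟨Set.Finite.subset hXB fun x hx ↦ ⟨hx.1, fun hxB ↦ ?_⟩, Set.Finite.subset hAX ?_⟩
    · obtain ⟨n, rfl⟩ := hsurj x hxB fun hxA ↦ hx.2 (.inl hxA)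
      exact hx.2 (.inr ⟨n, hx.1, rfl⟩)
    · rintro x ⟨hx | ⟨n, hn, rfl⟩, hxX⟩
      · exact ⟨hx, hxX⟩
      · exact (hxX hn).elim
  refine ⟨fun t ↦ .mk _ _ (hseg t), fun a b ↦ ?_, Set.Subset.antisymm ?_ ?_⟩
  · rw [mk_le_mk, AlmostSub.union_image_iff hg hgA, AlmostSub.union_image_iff hg hgA, hle]
  · rintro _ ⟨t, rfl⟩
    refine (starSeg_subset_iff (hseg t).1 (hseg t).2).2
      ⟨.of_subset Set.subset_union_left, .of_subset (Set.union_subset hAB ?_)⟩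
    rintro _ ⟨n, -, rfl⟩
    exact hgB n
  · intro r hr
    obtain ⟨X, Y, hXY, rfl⟩ := r.exists_eq_mk
    obtain ⟨hAX, hYB⟩ := (starSeg_subset_iff hXY.1 hXY.2).1 hr
    have ht : AlmostSub (g ⁻¹' X) (g ⁻¹' Y) ∧ ((g ⁻¹' Y) \ (g ⁻¹' X)).Infinite := by
      refine ⟨Set.Finite.preimage (f := g) hg.injOn hXY.1, fun hf ↦ hXY.2 ?_⟩
      refine ((hf.image g).union (Set.Finite.union hYB hAX)).subset fun x hx ↦ ?_
      by_cases hxB : x ∈ B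
      · by_cases hxA : x ∈ A
        · exact .inr (.inr ⟨hxA, hx.2⟩)
        · obtain ⟨n, rfl⟩ := hsurj x hxB hxA
          exact .inl ⟨n, hx, rfl⟩
      · exact .inr (.inl ⟨hx.1, hxB⟩)
    have hX := hpre X hAX (hXY.1.trans hYB)
    have hY := hpre Y (hAX.trans hXY.1) hYB
    set t := StarSegment.mk _ _ ht
    have h₁ : StarSegment.mk _ _ (h t) ≤ .mk _ _ ht := by rw [← hCD]
    have h₂ : StarSegment.mk _ _ ht ≤ .mk _ _ (h t) := by rw [← hCD]
    rw [mk_le_mk, ← AlmostSub.union_image_iff hg hgA,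
      ← AlmostSub.union_image_iff hg hgA (X := D t)] at h₁
    rw [mk_le_mk, ← AlmostSub.union_image_iff hg hgA,
      ← AlmostSub.union_image_iff hg hgA (Y := D t)] at h₂
    refine ⟨t, le_antisymm (mk_le_mk.2 ?_) (mk_le_mk.2 ?_)⟩
    · exact ⟨hX.1.trans h₁.1, h₁.2.trans hY.2⟩
    · exact ⟨h₂.1.trans hX.2, hY.1.trans h₂.2⟩

theorem StarSegment.mk_le_continuum : Cardinal.mk StarSegment ≤ Cardinal.continuum := by
  have hsurj : Function.Surjective fun p : {p : Set ℕ × Set ℕ //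
      AlmostSub p.1 p.2 ∧ (p.2 \ p.1).Infinite} ↦ StarSegment.mk p.1.1 p.1.2 p.2 := by
    intro s
    obtain ⟨A, B, h, rfl⟩ := s.exists_eq_mk
    exact ⟨⟨(A, B), h⟩, rfl⟩
  refine (Cardinal.mk_le_of_surjective hsurj).trans ((Cardinal.mk_subtype_le _).trans ?_)
  simp

theorem isVPartition_iff {P : Set (Set (Set ℕ))} :
    IsVPartition P ↔ ∃ Q : Set StarSegment, IsMaxAntichain Q ∧ P = Subtype.val '' Q := by
  constructor
  · rintro ⟨h₁, h₂, h₃⟩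
    refine ⟨Subtype.val ⁻¹' P, ⟨fun x hx y hy hxy ↦ ?_, fun t ↦ ?_⟩, ?_⟩
    · by_contra hne
      exact StarSegment.compat_iff.1 hxy (h₂ _ hx _ hy fun h ↦ hne (Subtype.ext h))
    · by_cases ht : t.1 ∈ P
      · exact ⟨t, ht, compat_of_le le_rfl⟩
      · obtain ⟨X, hX, h⟩ := h₃ t.1 t.2 ht
        exact ⟨⟨X, h₁ X hX⟩, hX, StarSegment.compat_iff.2 h⟩
    · ext X
      simpa using h₁ X
  · rintro ⟨Q, hQ, rfl⟩
    refine ⟨?_, ?_, fun R hR _ ↦ ?_⟩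
    · rintro _ ⟨x, -, rfl⟩
      exact x.2
    · rintro _ ⟨x, hx, rfl⟩ _ ⟨y, hy, rfl⟩ hne
      by_contra h
      exact hne (congrArg _ (hQ.eq_of_compat x hx y hy (StarSegment.compat_iff.2 h)))
    · obtain ⟨x, hx, h⟩ := hQ.exists_compat ⟨R, hR⟩
      exact ⟨x, ⟨x, hx, rfl⟩, StarSegment.compat_iff.1 h⟩

theorem shattering_image_iff (H : Set (Set StarSegment)) (hH : ∀ Q ∈ H, IsMaxAntichain Q) :
    Shattering ((fun Q ↦ Subtype.val '' Q) '' H) ↔ ∀ s : StarSegment, ∃ Q ∈ H,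
      ∃ x ∈ Q, ∃ y ∈ Q, x ≠ y ∧ Compat s x ∧ Compat s y := by
  have hcompat : ∀ x y : StarSegment, Compat y x ↔ IsStarSeg (x.1 ∩ y.1) := fun x y ↦ by
    rw [StarSegment.compat_iff, Set.inter_comm, y.2.inter_iff x.2]
  constructor
  · rintro ⟨-, h⟩ ⟨_, A, B, hAB, rfl⟩
    obtain ⟨_, ⟨Q, hQ, rfl⟩, _, ⟨x, hx, rfl⟩, _, ⟨y, hy, rfl⟩, hxy, hx', hy', -⟩ := h A B hAB
    exact ⟨Q, hQ, x, hx, y, hy, fun h ↦ hxy (congrArg _ h), (hcompat _ _).2 hx',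
      (hcompat _ _).2 hy'⟩
  · intro h
    refine ⟨?_, fun A B hAB ↦ ?_⟩
    · rintro _ ⟨Q, hQ, rfl⟩
      exact isVPartition_iff.2 ⟨Q, hH Q hQ, rfl⟩
    · obtain ⟨Q, hQ, x, hx, y, hy, hxy, hx', hy'⟩ := h ⟨_, A, B, hAB, rfl⟩
      rw [hcompat] at hx' hy'
      refine ⟨_, ⟨Q, hQ, rfl⟩, x, ⟨x, hx, rfl⟩, y, ⟨y, hy, rfl⟩,
        fun h ↦ hxy (Subtype.ext h), hx', hy', fun heq ↦ hxy ?_⟩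
      refine (hH Q hQ).eq_of_compat x hx y hy ⟨⟨_, hx'⟩, Set.inter_subset_left, ?_⟩
      exact heq.subset.trans Set.inter_subset_left

theorem _root_.IsVMatrix.exists_eq_image {H : Set (Set (Set (Set ℕ)))} (hH : IsVMatrix H) :
    ∃ H' : Set (Set StarSegment), (∀ Q ∈ H', IsMaxAntichain Q) ∧
      H = (fun Q ↦ Subtype.val '' Q) '' H' := by
  refine ⟨{Q | IsMaxAntichain Q ∧ Subtype.val '' Q ∈ H}, fun Q hQ ↦ hQ.1, ?_⟩
  ext P
  constructor
  · intro hP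
    obtain ⟨Q, hQ, rfl⟩ := isVPartition_iff.1 (hH P hP)
    exact ⟨Q, ⟨hQ, hP⟩, rfl⟩
  · rintro ⟨Q, hQ, rfl⟩
    exact hQ.2

theorem exists_shattering_mk_eq_kappaV :
    ∃ H : Set (Set StarSegment), (∀ Q ∈ H, IsMaxAntichain Q) ∧ Cardinal.mk H = kappaV ∧
      ∀ s : StarSegment, ∃ Q ∈ H, ∃ x ∈ Q, ∃ y ∈ Q, x ≠ y ∧ Compat s x ∧ Compat s y := by
  have hne : {c : Cardinal | ∃ H : Set (Set (Set (Set ℕ))),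
      Shattering H ∧ Cardinal.mk ↥H = c}.Nonempty := by
    refine ⟨_, _, (shattering_image_iff {Q | IsMaxAntichain Q} fun Q hQ ↦ hQ).2 fun s ↦ ?_, rfl⟩
    obtain ⟨t, hts, u, hus, htu⟩ := s.exists_not_compat
    obtain ⟨Q, htuQ, -, hQ⟩ := exists_isMaxAntichain (U := {t, u}) (Set.subset_univ _) (by
      rintro x (rfl | rfl) y (rfl | rfl) hxy
      · rfl
      · exact (htu hxy).elim
      · exact (htu hxy.symm).elim
      · rfl) fun t ↦ ⟨t, le_rfl, trivial⟩
    refine ⟨Q, hQ, t, htuQ (.inl rfl), u, htuQ (.inr rfl), ?_, (compat_of_le hts).symm,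
      (compat_of_le hus).symm⟩
    rintro rfl
    exact htu (compat_of_le le_rfl)
  obtain ⟨H, hH, hcard⟩ := csInf_mem hne
  obtain ⟨H, hmax, rfl⟩ := hH.1.exists_eq_image
  refine ⟨H, hmax, ?_, (shattering_image_iff H hmax).1 hH⟩
  rw [kappaV, ← hcard]
  exact (Cardinal.mk_image_eq (Set.image_injective.2 Subtype.val_injective)).symm

theorem exists_compat_le_one_of_lt_kappaV {I : Type} (hI : Cardinal.mk I < kappaV)
    (Q : I → Set StarSegment) (hQ : ∀ i, IsMaxAntichain (Q i)) :
    ∃ s, ∀ i, ∀ x ∈ Q i, ∀ y ∈ Q i, Compat s x → Compat s y → x = y := by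
  by_contra! hcon
  have hmax : ∀ P ∈ Set.range Q, IsMaxAntichain P := by
    rintro _ ⟨i, rfl⟩
    exact hQ i
  have hshat := (shattering_image_iff (Set.range Q) hmax).2 fun s ↦ by
    obtain ⟨i, x, hx, y, hy, hsx, hsy, hxy⟩ := hcon s
    exact ⟨_, ⟨i, rfl⟩, x, hx, y, hy, hxy, hsx, hsy⟩
  have hle : kappaV ≤ _ := csInf_le' ⟨_, hshat, rfl⟩
  exact absurd (hle.trans (Cardinal.mk_image_le.trans Cardinal.mk_range_le)) (not_le.2 hI)

end Segments

end BaseMatrix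

open BaseMatrix

/-- Theorem 11: there is a `≺`-decreasing transfinite sequence of v-partitions of
length `κ(v)` such that every *-segment contains a member of some partition. -/
theorem exists_base_vMatrix :
    ∃ P : Ordinal → Set (Set (Set ℕ)),
      (∀ α < kappaV.ord, IsVPartition (P α)) ∧
      (∀ α β : Ordinal, α < β → β < kappaV.ord → Refines (P β) (P α)) ∧
      (∀ A B : Set ℕ, IsSeg A B →
        ∃ α < kappaV.ord, ∃ C ∈ P α, C ⊆ StarSeg A B) := by
  classical
  obtain ⟨H, hH, hcard, hsplit⟩ := exists_shattering_mk_eq_kappaV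
  obtain ⟨f⟩ : Nonempty (kappaV.ord.ToType ≃ H) := Cardinal.eq.1 (by simp [hcard])
  let Q : Ordinal.{0} → Set StarSegment := fun α ↦
    if h : α < kappaV.ord then f (Ordinal.ToType.mk ⟨α, h⟩) else ∅
  have hQ : ∀ α (h : α < kappaV.ord), Q α = f (Ordinal.ToType.mk ⟨α, h⟩) := fun α h ↦ dif_pos h
  have : Nonempty StarSegment :=
    ⟨.mk ∅ Set.univ ⟨.of_subset (Set.empty_subset _), by simpa using Set.infinite_univ⟩⟩
  obtain ⟨P, hP, href, hbase⟩ := exists_base (κ := kappaV) StarSegment.separative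
    StarSegment.exists_le_of_antitone StarSegment.homogeneous StarSegment.mk_le_continuum
    (fun I hI Q hQ ↦ exists_compat_le_one_of_lt_kappaV hI Q hQ) (Q := Q)
    (fun α h ↦ hQ α h ▸ hH _ (f _).2) fun s ↦ by
      obtain ⟨R, hR, hs⟩ := hsplit s
      obtain ⟨⟨α, hα⟩, hi⟩ := (Ordinal.ToType.mk.toEquiv.trans f).surjective ⟨R, hR⟩
      have hQR : Q α = R := (hQ α hα).trans (congrArg Subtype.val hi)
      refine ⟨α, hα, ?_⟩
      rwa [hQR]
  refine ⟨fun α ↦ Subtype.val '' P α, fun α hα ↦ isVPartition_iff.2 ⟨_, hP α hα, rfl⟩, ?_, ?_⟩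
  · rintro α β hαβ hβ _ ⟨x, hx, rfl⟩
    obtain ⟨y, hy, hxy⟩ := href α β hαβ hβ hx
    exact ⟨y, ⟨y, hy, rfl⟩, hxy⟩
  · intro A B hAB
    obtain ⟨α, hα, x, hx, hle⟩ := hbase ⟨_, A, B, hAB, rfl⟩
    exact ⟨α, hα, x, ⟨x, hx, rfl⟩, hle⟩
end

section
/- If S ⊆ [ω]^ω is a v⁰-set, then there exists a v-partition P such that ∪P ∩ S = ∅. -/
open Set

theorem IsSeg.subset_of_seg_subset {A B C D : Set ℕ} (h : IsSeg C D) (hs : Seg C D ⊆ Seg A B) :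
    A ⊆ C ∧ D ⊆ B := by
  have hD : D.Infinite := h.2.mono sdiff_subset
  refine ⟨fun a ha => ?_, (hs ⟨hD, h.1, Subset.rfl⟩).2.2⟩
  by_contra hC
  have hmem : D \ {a} ∈ Seg C D :=
    ⟨hD.sdiff (finite_singleton a), subset_sdiff_singleton h.1 hC, sdiff_subset⟩
  exact ((hs hmem).2.1 ha).2 rfl

/-- Any segment shrinks so that no set with initial part `G` below `N` that lies in the shrunk
segment from `N` on belongs to the v⁰-set `S`. -/
theorem IsVZero.exists_avoiding_initial {S : Set (Set ℕ)} (hS : IsVZero S) {A B : Set ℕ}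
    (h : IsSeg A B) (N : ℕ) (G : Set ℕ) (hG : ∀ x ∈ G, x < N) :
    ∃ C D, IsSeg C D ∧ A ⊆ C ∧ D ⊆ B ∧ ∀ X : Set ℕ, X.Infinite →
      (∀ x < N, x ∈ X ↔ x ∈ G) → (∀ x ≥ N, (x ∈ C → x ∈ X) ∧ (x ∈ X → x ∈ D)) → X ∉ S := by
  have hseg : IsSeg ((A \ Iio N) ∪ G) ((B \ Iio N) ∪ G) := by
    refine ⟨union_subset_union_left _ (sdiff_subset_sdiff_left h.1), ?_⟩
    refine (h.2.sdiff (finite_Iio N)).mono ?_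
    intro x hx
    have := hG x
    simp only [mem_sdiff, mem_union, mem_Iio] at hx ⊢
    tauto
  obtain ⟨C, D, hCD, hsub, hdis⟩ := hS _ _ hseg
  obtain ⟨hC, hD⟩ := hCD.subset_of_seg_subset hsub
  refine ⟨(C \ Iio N) ∪ (A ∩ Iio N), (D \ Iio N) ∪ (B ∩ Iio N), ⟨?_, ?_⟩, ?_, ?_, ?_⟩
  · exact union_subset_union (sdiff_subset_sdiff_left hCD.1) (inter_subset_inter_left _ h.1)
  · refine (hCD.2.sdiff (finite_Iio N)).mono ?_
    intro x hx
    simp only [mem_sdiff, mem_union, mem_inter_iff, mem_Iio] at hx ⊢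
    tauto
  · intro x hx
    have := @hC x
    simp only [mem_sdiff, mem_union, mem_inter_iff, mem_Iio] at this ⊢
    tauto
  · intro x hx
    have := @hD x
    have := hG x
    simp only [mem_sdiff, mem_union, mem_inter_iff, mem_Iio] at *
    tauto
  · intro X hX hlow hhigh hXS
    have hmem : X ∈ Seg C D := by
      refine ⟨hX, fun x hx => ?_, fun x hx => ?_⟩
      · rcases lt_or_ge x N with hxN | hxN
        · rw [hlow x hxN]
          rcases hD (hCD.1 hx) with h' | h'
          · exact absurd hxN h'.2
          · exact h'
        · exact (hhigh x hxN).1 (Or.inl ⟨hx, not_lt.2 hxN⟩)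
      · rcases lt_or_ge x N with hxN | hxN
        · exact hCD.1 (hC (Or.inr ((hlow x hxN).1 hx)))
        · rcases (hhigh x hxN).2 hx with h' | h'
          · exact h'.1
          · exact absurd h'.2 (not_lt.2 hxN)
    exact (hdis ▸ (⟨hmem, hXS⟩ : X ∈ Seg C D ∩ S) : X ∈ (∅ : Set (Set ℕ)))

/-- Any segment shrinks so that no set lying in the shrunk segment from `N` on belongs to the
v⁰-set `S`. -/
theorem IsVZero.exists_avoiding_tail {S : Set (Set ℕ)} (hS : IsVZero S) {A B : Set ℕ}
    (h : IsSeg A B) (N : ℕ) :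
    ∃ C D, IsSeg C D ∧ A ⊆ C ∧ D ⊆ B ∧ ∀ X : Set ℕ, X.Infinite →
      (∀ x ≥ N, (x ∈ C → x ∈ X) ∧ (x ∈ X → x ∈ D)) → X ∉ S := by
  have key : ∀ T : Finset (Finset ℕ), (∀ G ∈ T, ∀ x ∈ G, x < N) →
      ∃ C D, IsSeg C D ∧ A ⊆ C ∧ D ⊆ B ∧ ∀ G ∈ T, ∀ X : Set ℕ, X.Infinite →
        (∀ x < N, x ∈ X ↔ x ∈ G) →
        (∀ x ≥ N, (x ∈ C → x ∈ X) ∧ (x ∈ X → x ∈ D)) → X ∉ S := by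
    intro T
    induction T using Finset.induction_on with
    | empty => exact fun _ => ⟨A, B, h, Subset.rfl, Subset.rfl, by simp⟩
    | insert G T _ ih =>
      intro hT
      obtain ⟨C, D, hCD, hAC, hDB, hav⟩ :=
        ih fun G' hG' => hT G' (Finset.mem_insert_of_mem hG')
      obtain ⟨C', D', hCD', hCC', hDD', hav'⟩ :=
        hS.exists_avoiding_initial hCD N (G : Set ℕ) (hT G (Finset.mem_insert_self _ _))
      refine ⟨C', D', hCD', hAC.trans hCC', hDD'.trans hDB, ?_⟩
      intro G' hG' X hX hlow hhigh
      rcases Finset.mem_insert.1 hG' with rfl | hG'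
      · exact hav' X hX hlow hhigh
      · exact hav G' hG' X hX hlow fun x hx =>
          ⟨fun hxC => (hhigh x hx).1 (hCC' hxC), fun hxX => hDD' ((hhigh x hx).2 hxX)⟩
  obtain ⟨C, D, hCD, hAC, hDB, hav⟩ := key (Finset.range N).powerset
    fun G hG x hx => Finset.mem_range.1 (Finset.mem_powerset.1 hG hx)
  refine ⟨C, D, hCD, hAC, hDB, fun X hX hhigh => ?_⟩
  classical
  refine hav ((Finset.range N).filter (· ∈ X))
    (Finset.mem_powerset.2 (Finset.filter_subset _ _)) X hX (fun x hx => ?_) hhigh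
  simp [hx]

/-- Every segment contains a segment whose *-segment is disjoint from the v⁰-set `S`. -/
theorem IsVZero.exists_starSeg_disjoint {S : Set (Set ℕ)} (hS : IsVZero S) {A B : Set ℕ}
    (h : IsSeg A B) :
    ∃ C D, IsSeg C D ∧ A ⊆ C ∧ D ⊆ B ∧ ∀ X ∈ StarSeg C D, X ∉ S := by
  have step : ∀ s : {p : (Set ℕ × Set ℕ) × ℕ // IsSeg p.1.1 p.1.2},
      ∃ t : {p : (Set ℕ × Set ℕ) × ℕ // IsSeg p.1.1 p.1.2}, ∃ k,
        k ∈ s.1.1.2 ∧ k ∉ s.1.1.1 ∧ s.1.2 ≤ k ∧ t.1.2 = k + 1 ∧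
        s.1.1.1 ⊆ t.1.1.1 ∧ t.1.1.2 ⊆ s.1.1.2 ∧ ∀ X : Set ℕ, X.Infinite →
          (∀ x ≥ k + 1, (x ∈ t.1.1.1 → x ∈ X) ∧ (x ∈ X → x ∈ t.1.1.2)) → X ∉ S := by
    rintro ⟨⟨⟨A, B⟩, N⟩, hAB⟩
    obtain ⟨k, hk, hNk⟩ := hAB.2.exists_gt N
    obtain ⟨C, D, hCD, hAC, hDB, hav⟩ := hS.exists_avoiding_tail hAB (k + 1)
    exact ⟨⟨⟨⟨C, D⟩, k + 1⟩, hCD⟩, k, hk.1, hk.2, hNk.le, rfl, hAC, hDB, hav⟩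
  choose next pick hB hA hle hN hmonoA hmonoB hav using step
  let s : ℕ → {p : (Set ℕ × Set ℕ) × ℕ // IsSeg p.1.1 p.1.2} :=
    fun n => next^[n] ⟨⟨⟨A, B⟩, 0⟩, h⟩
  have hs : ∀ n, s (n + 1) = next (s n) := fun n => Function.iterate_succ_apply' _ _ _
  let k : ℕ → ℕ := fun n => pick (s n)
  have hk : StrictMono k := strictMono_nat_of_lt_succ fun n => by
    have h1 := hle (s (n + 1))
    rw [hs n, hN (s n), ← hs n] at h1
    exact h1
  have hAm : Monotone fun n => (s n).1.1.1 := monotone_nat_of_le_succ fun n => by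
    rw [hs n]; exact hmonoA (s n)
  have hBm : Antitone fun n => (s n).1.1.2 := antitone_nat_of_succ_le fun n => by
    rw [hs n]; exact hmonoB (s n)
  have hkA : ∀ m i, m ≤ i → k i ∉ (s m).1.1.1 := fun m i hmi hx => hA (s i) (hAm hmi hx)
  have hkB : ∀ m i, m ≤ i → k i ∈ (s m).1.1.2 := fun m i hmi => hBm hmi (hB (s i))
  refine ⟨(⋃ n, (s n).1.1.1) \ range k, (⋂ n, (s n).1.1.2) ∪ range k, ⟨?_, ?_⟩, ?_, ?_, ?_⟩
  · rintro x ⟨hx, -⟩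
    obtain ⟨n, hn⟩ := mem_iUnion.1 hx
    refine Or.inl (mem_iInter.2 fun m => ?_)
    exact hBm (le_max_right n m) ((s (max n m)).2.1 (hAm (le_max_left n m) hn))
  · refine (infinite_range_of_injective hk.injective).mono fun x hx => ?_
    exact ⟨Or.inr hx, fun h' => h'.2 hx⟩
  · intro x hx
    refine ⟨mem_iUnion.2 ⟨0, hx⟩, ?_⟩
    rintro ⟨i, rfl⟩
    exact hkA 0 i (Nat.zero_le _) hx
  · rintro x (hx | ⟨i, rfl⟩)
    · exact mem_iInter.1 hx 0
    · exact hkB 0 i (Nat.zero_le _)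
  · rintro X ⟨hX, hCX, hXD⟩
    obtain ⟨M, hM⟩ := (hCX.union hXD).bddAbove
    have hbig : ∀ {x}, k M + 1 ≤ x → ∀ i, x = k i → M + 1 ≤ i := fun {x} hx i hi =>
      hk.lt_iff_lt.1 (by omega : k M < k i)
    have hout : ∀ {x}, k M + 1 ≤ x → x ∉ _ ∪ _ := fun {x} hx hmem => by
      have h1 := hM hmem
      have h2 := hk.id_le M
      simp only [id] at h2
      omega
    refine hav (s M) X hX fun x hx => ?_
    rw [← hs M]
    refine ⟨fun hxA => ?_, fun hxX => ?_⟩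
    · by_contra hxX
      refine hout hx (Or.inl ⟨⟨mem_iUnion.2 ⟨M + 1, hxA⟩, ?_⟩, hxX⟩)
      rintro ⟨i, rfl⟩
      exact hkA _ i (hbig hx i rfl) hxA
    · by_contra hxB
      refine hout hx (Or.inr ⟨hxX, ?_⟩)
      rintro (hx' | ⟨i, rfl⟩)
      · exact hxB (mem_iInter.1 hx' _)
      · exact hxB (hkB _ i (hbig hx i rfl))

theorem starSeg_subset_starSeg {A B C D : Set ℕ} (hAC : A ⊆ C) (hDB : D ⊆ B) :
    StarSeg C D ⊆ StarSeg A B := fun _ hX =>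
  ⟨hX.1, hX.2.1.subset (sdiff_subset_sdiff_left hAC), hX.2.2.subset (sdiff_subset_sdiff_right hDB)⟩

theorem IsSeg.not_countable_starSeg {A B : Set ℕ} (h : IsSeg A B) :
    ¬ (StarSeg A B).Countable := by
  intro hc
  let f := h.2.natEmbedding
  have hf : Function.Injective fun n => (f n : ℕ) := Subtype.val_injective.comp f.injective
  let g : Set ℕ → Set ℕ := fun X =>
    A ∪ (fun n => (f n : ℕ)) '' {n | n % 2 = 0 ∨ n / 2 ∈ X}
  have hg : ∀ X, g X ∈ StarSeg A B := by
    intro X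
    have hsub : g X ⊆ B := by
      rintro x (hx | ⟨n, -, rfl⟩)
      · exact h.1 hx
      · exact (f n).2.1
    refine ⟨?_, ?_, ?_⟩
    · refine Infinite.mono subset_union_right (Infinite.image hf.injOn ?_)
      refine (infinite_range_of_injective (f := fun n : ℕ => 2 * n)
        fun a b hab => by simpa using hab).mono ?_
      rintro _ ⟨n, rfl⟩
      exact Or.inl (by simp)
    · rw [AlmostSub, sdiff_eq_empty.2 subset_union_left]
      exact finite_empty
    · rw [AlmostSub, sdiff_eq_empty.2 hsub]
      exact finite_empty
  have hmem : ∀ X n, n ∈ X ↔ (f (2 * n + 1) : ℕ) ∈ g X := by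
    intro X n
    have hd : (2 * n + 1) / 2 = n := by omega
    have hm : (2 * n + 1) % 2 = 1 := by omega
    constructor
    · intro hn
      exact Or.inr ⟨2 * n + 1, Or.inr (by rwa [hd]), rfl⟩
    · rintro (hx | ⟨m, hm', he⟩)
      · exact absurd hx (f _).2.2
      · obtain rfl := hf he
        rcases hm' with h' | h'
        · omega
        · rwa [hd] at h'
  have hinj : Function.Injective g := fun X Y hXY => by
    ext n
    rw [hmem X, hmem Y, hXY]
  have : (univ : Set (Set ℕ)).Countable :=
    MapsTo.countable_of_injOn (fun X _ => hg X) hinj.injOn hc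
  have : Countable (Set ℕ) := countable_univ_iff.1 this
  obtain ⟨e, he⟩ := exists_surjective_nat (Set ℕ)
  exact Function.cantor_surjective e he

/-- Lemma 14: every v⁰-set is avoided by the union of some v-partition. -/
theorem vZero_avoided_by_vPartition (S : Set (Set ℕ)) (hS : IsVZero S) :
    ∃ P, IsVPartition P ∧ ⋃₀ P ∩ S = ∅ := by
  obtain ⟨P, hP⟩ := zorn_subset
    {P : Set (Set (Set ℕ)) | (∀ X ∈ P, IsStarSeg X ∧ ∀ x ∈ X, x ∉ S) ∧
      P.Pairwise StarDisjoint} (by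
      intro c hc hchain
      refine ⟨⋃₀ c, ⟨?_, ?_⟩, fun s hs => subset_sUnion_of_mem hs⟩
      · rintro X ⟨p, hp, hX⟩
        exact (hc hp).1 X hX
      · exact (pairwise_sUnion hchain.directedOn).2 fun p hp => (hc hp).2)
  refine ⟨P, ⟨fun X hX => (hP.prop.1 X hX).1, fun X hX Y hY => hP.prop.2 hX hY, ?_⟩, ?_⟩
  · rintro _ ⟨A, B, hAB, rfl⟩ -
    by_contra! hR
    obtain ⟨C, D, hCD, hAC, hDB, hav⟩ := hS.exists_starSeg_disjoint hAB
    have hsub := starSeg_subset_starSeg hAC hDB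
    have hdis : ∀ X ∈ P, StarDisjoint (StarSeg C D) X := fun X hX =>
      (hR X hX).mono (inter_subset_inter_left _ hsub)
    have hins : insert (StarSeg C D) P ⊆ P := by
      refine hP.le_of_ge ⟨?_, ?_⟩ (subset_insert _ _)
      · rintro X (rfl | hX)
        · exact ⟨⟨C, D, hCD, rfl⟩, hav⟩
        · exact hP.prop.1 X hX
      · refine hP.prop.2.insert fun X hX _ => ⟨hdis X hX, ?_⟩
        have := hdis X hX
        rwa [StarDisjoint, inter_comm] at this
    have := hdis _ (hins (mem_insert _ _))
    rw [StarDisjoint, inter_self] at this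
    exact hCD.not_countable_starSeg this
  · refine eq_empty_of_forall_notMem ?_
    rintro x ⟨⟨X, hX, hxX⟩, hxS⟩
    exact (hP.prop.1 X hX).2 x hxX hxS
end

section
/- add(v⁰) = add(v), i.e. the additivity number of the σ-ideal of v⁰-sets equals the additivity number of the σ-field of v-sets. -/
open Set

/-- `add(v⁰)`: the additivity number of the ideal of v⁰-sets. -/
noncomputable def addV0 : Cardinal :=
  sInf {c : Cardinal | ∃ F : Set (Set (Set ℕ)),
    (∀ S ∈ F, IsVZero S) ∧ ¬ IsVZero (⋃₀ F) ∧ Cardinal.mk ↥F = c}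

/-- `add(v)`: the additivity number of the σ-field of v-sets. -/
noncomputable def addV : Cardinal :=
  sInf {c : Cardinal | ∃ F : Set (Set (Set ℕ)),
    (∀ S ∈ F, IsVSet S) ∧ ¬ IsVSet (⋃₀ F) ∧ Cardinal.mk ↥F = c}

open Filter in
/-- The sets whose initial segments have even size, along a nonprincipal ultrafilter. -/
def evenParity : Set (Set ℕ) :=
  {X | ∀ᶠ n in (hyperfilter ℕ : Filter ℕ), Even (X ∩ Iio n).ncard}

open Filter in
theorem insert_mem_evenParity {X : Set ℕ} {m : ℕ} (hm : m ∉ X) :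
    insert m X ∈ evenParity ↔ X ∉ evenParity := by
  have hgt : ∀ᶠ n in (hyperfilter ℕ : Filter ℕ), m < n :=
    Nat.hyperfilter_le_atTop (eventually_gt_atTop m)
  have key : ∀ᶠ n in (hyperfilter ℕ : Filter ℕ),
      (Even (insert m X ∩ Iio n).ncard ↔ ¬ Even (X ∩ Iio n).ncard) := by
    filter_upwards [hgt] with n hn
    rw [insert_inter_of_mem (show m ∈ Iio n from hn),
      ncard_insert_of_notMem (fun h => hm h.1) ((finite_Iio n).inter_of_right X),
      Nat.even_add_one]
  simp only [evenParity, mem_ofPred_eq]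
  rw [eventually_congr key, Ultrafilter.eventually_not]

theorem IsSeg.exists_mem_evenParity {A B : Set ℕ} (h : IsSeg A B) :
    (∃ X ∈ Seg A B, X ∈ evenParity) ∧ ∃ X ∈ Seg A B, X ∉ evenParity := by
  obtain ⟨hAB, hinf⟩ := h
  obtain ⟨m, hmB, hmA⟩ := hinf.nonempty
  have hB : B ∈ Seg A B := ⟨hinf.mono sdiff_subset, hAB, Subset.rfl⟩
  have hBm : B \ {m} ∈ Seg A B :=
    ⟨(hinf.mono sdiff_subset).sdiff (finite_singleton m),
      fun x hx => ⟨hAB hx, fun h => hmA (h ▸ hx)⟩, sdiff_subset⟩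
  have hpar := insert_mem_evenParity (X := B \ {m}) (m := m) (fun h => h.2 rfl)
  rw [insert_sdiff_singleton, insert_eq_of_mem hmB] at hpar
  by_cases hT : B ∈ evenParity
  · exact ⟨⟨_, hB, hT⟩, _, hBm, hpar.1 hT⟩
  · exact ⟨⟨_, hBm, not_not.1 fun h => hT (hpar.2 h)⟩, _, hB, hT⟩

theorem IsVZero.isVSet {S : Set (Set ℕ)} (h : IsVZero S) : IsVSet S := fun A B hAB =>
  let ⟨C, D, hCD, hsub, hdisj⟩ := h A B hAB
  ⟨C, D, hCD, hsub, Or.inr hdisj⟩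

theorem IsVZero.mono {S T : Set (Set ℕ)} (h : IsVZero S) (hTS : T ⊆ S) : IsVZero T :=
  fun A B hAB =>
    let ⟨C, D, hCD, hsub, hdisj⟩ := h A B hAB
    ⟨C, D, hCD, hsub, subset_empty_iff.1 (hdisj ▸ inter_subset_inter_right _ hTS)⟩

/-- If both `U` and its even-parity part are v-sets, then `U` is a v⁰-set. -/
theorem isVZero_of_isVSet_inter_evenParity {U : Set (Set ℕ)} (hU : IsVSet U)
    (hUT : IsVSet (U ∩ evenParity)) : IsVZero U := by
  intro A B hAB
  obtain ⟨C, D, hCD, hsub, hin | hout⟩ := hU A B hAB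
  · obtain ⟨C', D', hCD', hsub', hin' | hout'⟩ := hUT C D hCD
    · obtain ⟨X, hX, hXT⟩ := hCD'.exists_mem_evenParity.2
      exact absurd (hin' hX).2 hXT
    · obtain ⟨X, hX, hXT⟩ := hCD'.exists_mem_evenParity.1
      exact absurd (show X ∈ Seg C' D' ∩ (U ∩ evenParity) from ⟨hX, hin (hsub' hX), hXT⟩)
        (hout' ▸ notMem_empty X)
  · exact ⟨C, D, hCD, hsub, hout⟩

/-- Every segment is contained in a given segment or contains a segment disjoint from it. -/
theorem IsSeg.subset_or_exists_disjoint {A B C D : Set ℕ} (h : IsSeg C D) :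
    Seg C D ⊆ Seg A B ∨
      ∃ C' D', IsSeg C' D' ∧ Seg C' D' ⊆ Seg C D ∧ Seg C' D' ∩ Seg A B = ∅ := by
  obtain ⟨hCD, hinf⟩ := h
  by_cases hDB : D ⊆ B
  · by_cases hAC : A ⊆ C
    · exact Or.inl fun X hX => ⟨hX.1, hAC.trans hX.2.1, hX.2.2.trans hDB⟩
    · obtain ⟨n, hnA, hnC⟩ := not_subset.1 hAC
      refine Or.inr ⟨C, D \ {n}, ⟨fun x hx => ⟨hCD hx, fun h => hnC (h ▸ hx)⟩, ?_⟩,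
        fun X hX => ⟨hX.1, hX.2.1, hX.2.2.trans sdiff_subset⟩, ?_⟩
      · rw [sdiff_right_comm]
        exact hinf.sdiff (finite_singleton n)
      · exact eq_empty_of_forall_notMem fun X hX => (hX.1.2.2 (hX.2.2.1 hnA)).2 rfl
  · obtain ⟨n, hnD, hnB⟩ := not_subset.1 hDB
    refine Or.inr ⟨insert n C, D, ⟨insert_subset hnD hCD, ?_⟩,
      fun X hX => ⟨hX.1, (subset_insert n C).trans hX.2.1, hX.2.2⟩, ?_⟩
    · rw [← union_singleton, ← sdiff_sdiff]
      exact hinf.sdiff (finite_singleton n)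
    · exact eq_empty_of_forall_notMem fun X hX => hnB (hX.2.2.2 (hX.1.2.1 (mem_insert n C)))

/-- A v-set containing no subsegment of `⟨A,B⟩` has a v⁰ trace on `⟨A,B⟩`. -/
theorem IsVSet.isVZero_inter_seg {S : Set (Set ℕ)} (hS : IsVSet S) {A B : Set ℕ}
    (hno : ∀ C D, IsSeg C D → Seg C D ⊆ Seg A B → ¬ Seg C D ⊆ S) :
    IsVZero (S ∩ Seg A B) := by
  intro C D hCD
  obtain hsub | ⟨C', D', hCD', hsub', hdisj⟩ := hCD.subset_or_exists_disjoint (A := A) (B := B)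
  · obtain ⟨C', D', hCD', hsub', hin | hout⟩ := hS C D hCD
    · exact absurd hin (hno C' D' hCD' (hsub'.trans hsub))
    · exact ⟨C', D', hCD', hsub',
        subset_empty_iff.1 (hout ▸ inter_subset_inter_right _ inter_subset_left)⟩
  · exact ⟨C', D', hCD', hsub',
      subset_empty_iff.1 (hdisj ▸ inter_subset_inter_right _ inter_subset_right)⟩

theorem sUnion_image_inter_right {α : Type*} (F : Set (Set α)) (T : Set α) :
    ⋃₀ ((fun S => S ∩ T) '' F) = ⋃₀ F ∩ T := by
  rw [sUnion_image, sUnion_eq_biUnion, iUnion₂_inter]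

theorem exists_isVSet_family {F : Set (Set (Set ℕ))} (hF : ∀ S ∈ F, IsVZero S)
    (hU : ¬ IsVZero (⋃₀ F)) :
    ∃ G : Set (Set (Set ℕ)), (∀ S ∈ G, IsVSet S) ∧ ¬ IsVSet (⋃₀ G) ∧
      Cardinal.mk ↥G ≤ Cardinal.mk ↥F := by
  by_cases hV : IsVSet (⋃₀ F)
  · refine ⟨(fun S => S ∩ evenParity) '' F, ?_, ?_, Cardinal.mk_image_le⟩
    · rintro _ ⟨S, hS, rfl⟩
      exact ((hF S hS).mono inter_subset_left).isVSet
    · rw [sUnion_image_inter_right]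
      exact fun h => hU (isVZero_of_isVSet_inter_evenParity hV h)
  · exact ⟨F, fun S hS => (hF S hS).isVSet, hV, le_rfl⟩

theorem exists_isVZero_family {F : Set (Set (Set ℕ))} (hF : ∀ S ∈ F, IsVSet S)
    (hU : ¬ IsVSet (⋃₀ F)) :
    ∃ G : Set (Set (Set ℕ)), (∀ S ∈ G, IsVZero S) ∧ ¬ IsVZero (⋃₀ G) ∧
      Cardinal.mk ↥G ≤ Cardinal.mk ↥F := by
  simp only [IsVSet, not_forall] at hU
  obtain ⟨A, B, hAB, hU⟩ := hU
  refine ⟨(fun S => S ∩ Seg A B) '' F, ?_, ?_, Cardinal.mk_image_le⟩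
  · rintro _ ⟨S, hS, rfl⟩
    exact (hF S hS).isVZero_inter_seg fun C D hCD hsub hin =>
      hU ⟨C, D, hCD, hsub, Or.inl (hin.trans (subset_sUnion_of_mem hS))⟩
  · rw [sUnion_image_inter_right]
    intro h
    obtain ⟨C, D, hCD, hsub, hdisj⟩ := h A B hAB
    refine hU ⟨C, D, hCD, hsub, Or.inr (eq_empty_of_forall_notMem fun X hX => ?_)⟩
    exact notMem_empty X (hdisj ▸ ⟨hX.1, hX.2, hsub hX.1⟩)

theorem Cardinal.sInf_le_sInf_of_forall_exists_le {s t : Set Cardinal}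
    (hst : ∀ c ∈ s, ∃ d ∈ t, d ≤ c) (hts : ∀ d ∈ t, ∃ c ∈ s, c ≤ d) : sInf s ≤ sInf t := by
  obtain rfl | ht := t.eq_empty_or_nonempty
  · obtain rfl : s = ∅ := eq_empty_of_forall_notMem fun c hc =>
      let ⟨d, hd, _⟩ := hst c hc
      hd
    exact le_rfl
  · obtain ⟨c, hc, hle⟩ := hts _ (csInf_mem ht)
    exact (csInf_le' hc).trans hle

/-- Theorem 16: `add(v⁰) = add(v)`. -/
theorem addV0_eq_addV : addV0 = addV := by
  apply le_antisymm <;> apply Cardinal.sInf_le_sInf_of_forall_exists_le <;>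
    rintro _ ⟨F, hF, hU, rfl⟩
  · obtain ⟨G, hG, hGU, hle⟩ := exists_isVSet_family hF hU
    exact ⟨_, ⟨G, hG, hGU, rfl⟩, hle⟩
  · obtain ⟨G, hG, hGU, hle⟩ := exists_isVZero_family hF hU
    exact ⟨_, ⟨G, hG, hGU, rfl⟩, hle⟩
  · obtain ⟨G, hG, hGU, hle⟩ := exists_isVZero_family hF hU
    exact ⟨_, ⟨G, hG, hGU, rfl⟩, hle⟩
  · obtain ⟨G, hG, hGU, hle⟩ := exists_isVSet_family hF hU
    exact ⟨_, ⟨G, hG, hGU, rfl⟩, hle⟩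
end
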